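/- Let \(E \in \mathbb{R}^d\) be a nonzero vector, \(e = E/\|E\|\), \(\gamma > 0\), and let Z be a standard d-dimensional Gaussian random variable. Then \(\mathbb{E}[\|E - 2\sqrt{\gamma} e e^\top Z\| \,(1 - p_\gamma(\sqrt{\gamma}Z))] \leq \|E\|\), where \(p_\gamma(z) = 1 \wedge \varphi_\gamma(\|E\| - \langle e, z\rangle)/\varphi_\gamma(\langle e, z\rangle)\) and \(\varphi_\gamma\) is the density of the one-dimensional centered Gaussian with variance \(\gamma\). -/

import Mathlib

open Real MeasureTheory ProbabilityTheory
open scoped RealInnerProductSpace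

/-- The standard `d`-dimensional Gaussian measure on `EuclideanSpace ℝ (Fin d)`. -/
noncomputable def stdGaussian (d : ℕ) : Measure (EuclideanSpace ℝ (Fin d)) :=
  (Measure.pi fun _ : Fin d => gaussianReal 0 1).map
    ⇑(EuclideanSpace.equiv (Fin d) ℝ).symm

/-- The density of the one-dimensional centered Gaussian with variance `γ`. -/
noncomputable def gaussDensity (γ t : ℝ) : ℝ :=
  (Real.sqrt (2 * Real.pi * γ))⁻¹ * Real.exp (-t ^ 2 / (2 * γ))

lemma gaussDensity_eq_pdf (γ : ℝ) (hγ : 0 < γ) (t : ℝ) :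
    gaussDensity γ t = gaussianPDFReal 0 γ.toNNReal t := by
  simp [gaussDensity, gaussianPDFReal, Real.coe_toNNReal _ hγ.le]

lemma gaussDensity_pos (γ : ℝ) (hγ : 0 < γ) (t : ℝ) : 0 < gaussDensity γ t := by
  unfold gaussDensity; positivity

lemma gaussDensity_le_iff (γ : ℝ) (hγ : 0 < γ) (s t : ℝ) :
    gaussDensity γ s ≤ gaussDensity γ t ↔ t ^ 2 ≤ s ^ 2 := by
  unfold gaussDensity
  rw [mul_le_mul_iff_right₀ (by positivity), Real.exp_le_exp,
    div_le_div_iff_of_pos_right (by positivity), neg_le_neg_iff]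

/-- The law of the one-dimensional projection. -/
lemma map_proj_stdGaussian (d : ℕ) (γ : ℝ) (hγ : 0 < γ)
    (e : EuclideanSpace ℝ (Fin d)) (he : ‖e‖ = 1) :
    (_root_.stdGaussian d).map (fun z => Real.sqrt γ * ⟪e, z⟫) = gaussianReal 0 γ.toNNReal := by
  have h1 : _root_.stdGaussian d = ProbabilityTheory.stdGaussian (EuclideanSpace ℝ (Fin d)) := by
    rw [← map_pi_eq_stdGaussian]
    rfl
  rw [h1]
  have h2 := IsGaussian.map_eq_gaussianReal
    (μ := ProbabilityTheory.stdGaussian (EuclideanSpace ℝ (Fin d)))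
    (Real.sqrt γ • innerSL ℝ e)
  rw [integral_strongDual_stdGaussian, variance_dual_stdGaussian] at h2
  have h3 : ‖Real.sqrt γ • innerSL ℝ e‖ ^ 2 = γ := by
    rw [norm_smul, innerSL_apply_norm, he, mul_one, Real.norm_eq_abs, sq_abs, Real.sq_sqrt hγ.le]
  rw [h3] at h2
  exact h2

/-- The one-dimensional estimate (an equality). -/
lemma integral_one_dim (γ : ℝ) (hγ : 0 < γ) (r : ℝ) (hr : 0 ≤ r) :
    ∫ w, |r - 2 * w| * (1 - min 1 (gaussDensity γ (r - w) / gaussDensity γ w))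
      ∂(gaussianReal 0 γ.toNNReal) = r := by
  have hv : γ.toNNReal ≠ 0 := by simpa using hγ
  set F : ℝ → ℝ := fun w =>
    |r - 2 * w| * (1 - min 1 (gaussDensity γ (r - w) / gaussDensity γ w)) with hF
  set G : ℝ → ℝ := fun w => gaussDensity γ w * F w with hG
  set H : ℝ → ℝ := fun w => gaussDensity γ w * (r - 2 * w) with hH
  have hid : Integrable (fun x : ℝ => x) (gaussianReal 0 γ.toNNReal) :=
    (memLp_id_gaussianReal (μ := 0) (v := γ.toNNReal) 1).integrable le_rfl
  have hlin : Integrable (fun x : ℝ => r - 2 * x) (gaussianReal 0 γ.toNNReal) :=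
    (integrable_const r).sub (hid.const_mul 2)
  have hHval : ∫ w, H w = r := by
    have : ∫ w, H w = ∫ w, (r - 2 * w) ∂(gaussianReal 0 γ.toNNReal) := by
      rw [integral_gaussianReal_eq_integral_smul hv]
      simp only [hH, gaussDensity_eq_pdf γ hγ, smul_eq_mul]
    rw [this, integral_sub (integrable_const r) (hid.const_mul 2), integral_const_mul,
      integral_id_gaussianReal]
    simp
  have hHint : Integrable H := by
    rw [gaussianReal_of_var_ne_zero _ hv, integrable_withDensity_iff_integrable_smul'
      (measurable_gaussianPDF _ _) (Filter.Eventually.of_forall fun _ => gaussianPDF_lt_top)] at hlin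
    simpa only [toReal_gaussianPDF, hH, gaussDensity_eq_pdf γ hγ, smul_eq_mul] using hlin
  have hmeas : Measurable (gaussDensity γ) := by unfold gaussDensity; fun_prop
  have hGmeas : Measurable G := by simp only [hG, hF]; fun_prop
  have hp : ∀ w, 0 ≤ gaussDensity γ (r - w) / gaussDensity γ w := fun w =>
    div_nonneg (gaussDensity_pos γ hγ _).le (gaussDensity_pos γ hγ _).le
  have hGint : Integrable G := by
    refine hHint.mono hGmeas.aestronglyMeasurable (Filter.Eventually.of_forall fun w => ?_)
    simp only [hG, hF, hH, norm_mul, Real.norm_eq_abs, abs_abs]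
    have h0 : 0 ≤ min 1 (gaussDensity γ (r - w) / gaussDensity γ w) := le_min zero_le_one (hp w)
    have h1 : min 1 (gaussDensity γ (r - w) / gaussDensity γ w) ≤ 1 := min_le_left _ _
    have h2 : |1 - min 1 (gaussDensity γ (r - w) / gaussDensity γ w)| ≤ 1 := by
      rw [abs_le]; constructor <;> linarith
    exact mul_le_mul_of_nonneg_left (mul_le_of_le_one_right (abs_nonneg _) h2) (abs_nonneg _)
  have hGlow : ∀ w, w ≤ r / 2 → G w = H w + H (r - w) := by
    intro w hw
    have hle : gaussDensity γ (r - w) ≤ gaussDensity γ w := by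
      rw [gaussDensity_le_iff γ hγ]; nlinarith
    have hpos := gaussDensity_pos γ hγ w
    simp only [hG, hF, hH]
    rw [min_eq_right ((div_le_one hpos).2 hle), abs_of_nonneg (by linarith)]
    field_simp
    ring
  have hGhigh : ∀ w, r / 2 ≤ w → G w = 0 := by
    intro w hw
    have hle : gaussDensity γ w ≤ gaussDensity γ (r - w) := by
      rw [gaussDensity_le_iff γ hγ]; nlinarith
    have hpos := gaussDensity_pos γ hγ w
    simp only [hG, hF]
    rw [min_eq_left ((one_le_div hpos).2 hle)]
    ring
  have hsym : ∀ w, G w + G (r - w) = H w + H (r - w) := by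
    intro w
    rcases le_total w (r / 2) with hw | hw
    · rw [hGlow w hw, hGhigh (r - w) (by linarith), add_zero]
    · rw [hGhigh w hw, hGlow (r - w) (by linarith), sub_sub_cancel, zero_add, add_comm]
  have hGH : ∫ w, G w = ∫ w, H w := by
    have h := integral_congr_ae (μ := (volume : Measure ℝ)) (Filter.Eventually.of_forall hsym)
    rw [integral_add hGint (hGint.comp_sub_left r), integral_add hHint (hHint.comp_sub_left r),
      integral_sub_left_eq_self G volume r, integral_sub_left_eq_self H volume r] at h
    linarith
  rw [integral_gaussianReal_eq_integral_smul hv]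
  refine Eq.trans ?_ (hGH.trans hHval)
  simp only [hG, hF, gaussDensity_eq_pdf γ hγ, smul_eq_mul]

/-- the one-step reflection-coupling estimate (68). -/
theorem reflection_coupling_one_step (d : ℕ) (γ : ℝ) (hγ : 0 < γ)
    (E : EuclideanSpace ℝ (Fin d)) (hE : E ≠ 0) :
    (∫ z, ‖E - (2 * Real.sqrt γ * ⟪‖E‖⁻¹ • E, z⟫) • (‖E‖⁻¹ • E)‖ *
        (1 - min 1
          (gaussDensity γ (‖E‖ - Real.sqrt γ * ⟪‖E‖⁻¹ • E, z⟫) /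
            gaussDensity γ (Real.sqrt γ * ⟪‖E‖⁻¹ • E, z⟫))) ∂(stdGaussian d))
      ≤ ‖E‖ := by
  have hr : 0 < ‖E‖ := norm_pos_iff.2 hE
  set e := ‖E‖⁻¹ • E with he_def
  have he : ‖e‖ = 1 := by
    rw [he_def, norm_smul, norm_inv, norm_norm, inv_mul_cancel₀ hr.ne']
  have hEe : E = ‖E‖ • e := by rw [he_def, smul_smul, mul_inv_cancel₀ hr.ne', one_smul]
  have hnorm : ∀ c : ℝ, ‖E - c • e‖ = |‖E‖ - c| := by
    intro c
    have : E - c • e = (‖E‖ - c) • e := by rw [sub_smul, ← hEe]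
    rw [this, norm_smul, he, mul_one, Real.norm_eq_abs]
  have hmeas : Measurable (gaussDensity γ) := by unfold gaussDensity; fun_prop
  have key := integral_one_dim γ hγ ‖E‖ hr.le
  rw [← map_proj_stdGaussian d γ hγ e he, integral_map (by fun_prop)
    (Measurable.aestronglyMeasurable (by fun_prop))] at key
  refine le_of_eq (Eq.trans ?_ key)
  refine integral_congr_ae (Filter.Eventually.of_forall fun z => ?_)
  simp only [hnorm, mul_assoc]
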